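/- Fix z ∈ ℝ and ε > 0, and let κ := ℙ_0(S_m ≠ 0 for all m ≥ 1) ∈ (0,1). There exists a constant C' > 0 such that for all n, Σ over pairs α, β ∈ V_N with α ≠ β and ‖α−β‖ ≤ (log N)^{2+2ε} of P(φ_α > u_N(z), φ_β > u_N(z)) is at most C'·N^{−κ/(2−κ)}·(log N)^{d(2+2ε)}·max{e^{−2z}·1_{z≤0}, e^{−2z/(2−κ)}·1_{z>0}}; in particular this double sum tends to 0 as n → ∞. -/

import Mathlib

open MeasureTheory ProbabilityTheory Real Filter Set

/-- `ℤ^d` as functions `Fin d → ℤ`. -/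
abbrev Zd (d : ℕ) := Fin d → ℤ

/-- One step of the simple random walk: move from `a` by `±1` in coordinate `i`. -/
def rwStep (d : ℕ) (i : Fin d) (s : Bool) (a : Zd d) : Zd d :=
  Function.update a i (a i + if s then 1 else -1)

/-- `m`-step transition probability of the simple random walk on `ℤ^d`. -/
noncomputable def rwP (d : ℕ) : ℕ → Zd d → Zd d → ℝ
  | 0, a, b => if a = b then 1 else 0
  | (m+1), a, b => (1 / (2 * d)) * ∑ i : Fin d, ∑ s : Bool, rwP d m (rwStep d i s a) b

/-- The Green's function `g(a,b)` of the simple random walk on `ℤ^d`. -/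
noncomputable def green (d : ℕ) (a b : Zd d) : ℝ := ∑' m, rwP d m a b

open Classical in
/-- Probability that the walk started at `a` is at `b` at time `m`, having stayed in `Λ`
at all times `0,…,m`. -/
noncomputable def rwPIn (d : ℕ) (Λ : Set (Zd d)) : ℕ → Zd d → Zd d → ℝ
  | 0, a, b => if a = b ∧ a ∈ Λ then 1 else 0
  | (m+1), a, b =>
      if a ∈ Λ then (1 / (2 * d)) * ∑ i : Fin d, ∑ s : Bool, rwPIn d Λ m (rwStep d i s a) b
      else 0

/-- Dirichlet Green's function `g_Λ(a,b)` (killed upon exiting `Λ`). -/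
noncomputable def greenIn (d : ℕ) (Λ : Set (Zd d)) (a b : Zd d) : ℝ := ∑' m, rwPIn d Λ m a b

open Classical in
/-- Probability that the walk started at `a` first hits `F` at time `m`, at the point `b`. -/
noncomputable def hitP (d : ℕ) (F : Set (Zd d)) : ℕ → Zd d → Zd d → ℝ
  | 0, a, b => if a = b ∧ b ∈ F then 1 else 0
  | (m+1), a, b =>
      if a ∈ F then 0
      else (1 / (2 * d)) * ∑ i : Fin d, ∑ s : Bool, hitP d F m (rwStep d i s a) b

open Classical in
/-- Probability that the walk started at `a` first hits `F` at time `m`, at the point `b`,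
before exiting `Λ`. -/
noncomputable def hitPIn (d : ℕ) (Λ F : Set (Zd d)) : ℕ → Zd d → Zd d → ℝ
  | 0, a, b => if a = b ∧ b ∈ F ∧ b ∈ Λ then 1 else 0
  | (m+1), a, b =>
      if a ∈ Λ ∧ a ∉ F then
        (1 / (2 * d)) * ∑ i : Fin d, ∑ s : Bool, hitPIn d Λ F m (rwStep d i s a) b
      else 0

/-- `ℙ_a(H_F < ∞, S_{H_F} = b)`, the harmonic measure of `F` seen from `a`. -/
noncomputable def hitMeas (d : ℕ) (F : Set (Zd d)) (a b : Zd d) : ℝ := ∑' m, hitP d F m a b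

/-- `ℙ_a(H_F < H_{ℤ^d∖Λ}, S_{H_F} = b)`. -/
noncomputable def hitMeasIn (d : ℕ) (Λ F : Set (Zd d)) (a b : Zd d) : ℝ :=
  ∑' m, hitPIn d Λ F m a b

/-- `(φ_a)_{a∈ℤ^d}` is a centered Gaussian field with covariance `G`: every finite linear
combination is a centered Gaussian with the prescribed variance. -/
def IsGaussianField {Ω : Type*} [MeasurableSpace Ω] (P : Measure Ω) (d : ℕ)
    (G : Zd d → Zd d → ℝ) (φ : Zd d → Ω → ℝ) : Prop :=
  (∀ a, Measurable (φ a)) ∧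
    ∀ c : Zd d →₀ ℝ,
      Measure.map (fun ω => ∑ a ∈ c.support, c a * φ a ω) P =
        gaussianReal 0
          (Real.toNNReal (∑ a ∈ c.support, ∑ b ∈ c.support, c a * c b * G a b))

/-- The centering sequence `b_N` (here `g0 = g(0)` is the variance of the field). -/
noncomputable def bN (g0 : ℝ) (N : ℕ) : ℝ :=
  Real.sqrt g0 * (Real.sqrt (2 * Real.log N) -
    (Real.log (Real.log N) + Real.log (4 * π)) / (2 * Real.sqrt (2 * Real.log N)))

/-- The scaling sequence `a_N = g(0)/b_N`. -/
noncomputable def aN (g0 : ℝ) (N : ℕ) : ℝ := g0 / bN g0 N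

/-- `u_N(z) = a_N z + b_N`. -/
noncomputable def uN (g0 : ℝ) (N : ℕ) (z : ℝ) : ℝ := aN g0 N * z + bN g0 N

/-- The box `V_N = ([0,n-1]^d) ∩ ℤ^d`, `N = n^d`. -/
noncomputable def VN (d n : ℕ) : Finset (Zd d) :=
  Fintype.piFinset fun _ => Finset.Icc (0 : ℤ) ((n : ℤ) - 1)

/-- The `ℓ∞` distance between two points of `ℤ^d`, as a real number. -/
noncomputable def distInf (d : ℕ) (a b : Zd d) : ℝ :=
  ((Finset.univ.sup fun i => (a i - b i).natAbs : ℕ) : ℝ)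

open Classical in
/-- The bulk `V_N^δ` of the box `V_N`. -/
noncomputable def bulk (d n : ℕ) (δ : ℝ) : Finset (Zd d) :=
  (VN d n).filter fun a => ∀ b : Zd d, b ∉ VN d n → δ * n < distInf d a b

/-- The rectangle `∏_i ([0,1] ∩ (lo i, hi i])` in `[0,1]^d`. -/
def rect (d : ℕ) (lo hi : Fin d → ℝ) : Set (Fin d → ℝ) :=
  {t | ∀ i, t i ∈ Set.Icc (0 : ℝ) 1 ∩ Set.Ioc (lo i) (hi i)}

open Classical in
/-- `nA ∩ V_N = {α ∈ V_N : α/n ∈ A}` for the rectangle `A = rect d lo hi`. -/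
noncomputable def rectIdx (d n : ℕ) (lo hi : Fin d → ℝ) : Finset (Zd d) :=
  (VN d n).filter fun a => (fun i => (a i : ℝ) / n) ∈ rect d lo hi

/-- `e^{-y}` for `y ∈ (-∞,+∞]`, with the convention `e^{-∞} = 0`. -/
noncomputable def expE (y : EReal) : ℝ := if y = ⊤ then 0 else Real.exp (-y.toReal)

/-- `u_N` extended to `(-∞,+∞]` by `u_N(+∞) = +∞`. -/
noncomputable def uNE (g0 : ℝ) (N : ℕ) (y : EReal) : EReal :=
  if y = ⊤ then ⊤ else ((uN g0 N y.toReal : ℝ) : EReal)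

/-- `ω(R) = ∫_R e^{-z} dz` for `R ⊆ (-∞,+∞]`. -/
noncomputable def omegaMeas (R : Set EReal) : ℝ :=
  ∫ t in {t : ℝ | (t : EReal) ∈ R}, Real.exp (-t)

/-- `R ⊆ (-∞,+∞]` is a finite union of disjoint intervals `(x,y]` with
`-∞ < x < y ≤ +∞`. -/
def IsFiniteUnionIoc (R : Set EReal) : Prop :=
  ∃ (m : ℕ) (w : Fin m → ℝ) (r : Fin m → EReal),
    (∀ l, (w l : EReal) < r l) ∧
    (Pairwise fun l l' =>
      Disjoint (Set.Ioc (w l : EReal) (r l)) (Set.Ioc (w l' : EReal) (r l'))) ∧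
    R = ⋃ l, Set.Ioc ((w l : ℝ) : EReal) (r l)


/-- `ℙ_0(∃ m ≥ 1, S_m = 0)`, the return probability of the simple random walk. -/
noncomputable def returnProb (d : ℕ) : ℝ :=
  (1 / (2 * d)) * ∑ i : Fin d, ∑ s : Bool, hitMeas d {0} (rwStep d i s 0) 0

/-- `κ = ℙ_0(S_m ≠ 0 for all m ≥ 1)`, the escape probability. -/
noncomputable def kappa (d : ℕ) : ℝ := 1 - returnProb d

open Classical in
/-- The sum over pairs `α ≠ β ∈ V_N` with `‖α-β‖ ≤ (log N)^{2+2ε}` of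
`P(φ_α > u_N(z), φ_β > u_N(z))`. -/
noncomputable def pairSum (d n : ℕ) (ε : ℝ) {Ω : Type*} [MeasurableSpace Ω] (P : Measure Ω)
    (φ : Zd d → Ω → ℝ) (z : ℝ) : ℝ :=
  ∑ p ∈ ((VN d n) ×ˢ (VN d n)).filter
      (fun p => p.1 ≠ p.2 ∧ distInf d p.1 p.2 ≤ (Real.log ((n ^ d : ℕ) : ℝ)) ^ (2 + 2 * ε)),
    (P {ω | uN (green d 0 0) (n ^ d) z < φ p.1 ω ∧
            uN (green d 0 0) (n ^ d) z < φ p.2 ω}).toReal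

section RandomWalk

/-- The average of `f` over the `2d` nearest neighbours of `x`. -/
noncomputable def stepAverage (d : ℕ) (f : Zd d → ℝ) (x : Zd d) : ℝ :=
  (1 / (2 * d)) * ∑ i : Fin d, ∑ s : Bool, f (rwStep d i s x)

/-- The step `±1` in coordinate `i`. -/
def stepVec (d : ℕ) (i : Fin d) (s : Bool) : Zd d := Pi.single i (if s then 1 else -1)

variable {d : ℕ}

lemma rwStep_eq_add (i : Fin d) (s : Bool) (x : Zd d) :
    rwStep d i s x = x + stepVec d i s := by
  funext j
  by_cases h : j = i
  · subst h; simp [rwStep, stepVec]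
  · simp [rwStep, stepVec, h]

lemma neg_stepVec (i : Fin d) (s : Bool) : -stepVec d i s = stepVec d i (!s) := by
  cases s <;> simp [stepVec, ← Pi.single_neg]

lemma rwP_succ (m : ℕ) (a b : Zd d) :
    rwP d (m + 1) a b = stepAverage d (fun y => rwP d m y b) a := rfl

lemma stepAverage_mono {f g : Zd d → ℝ} {x : Zd d}
    (h : ∀ i s, f (rwStep d i s x) ≤ g (rwStep d i s x)) :
    stepAverage d f x ≤ stepAverage d g x := by
  unfold stepAverage
  gcongr with i _ s _
  exact h i s

lemma stepAverage_const (hd : d ≠ 0) (c : ℝ) (x : Zd d) :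
    stepAverage d (fun _ => c) x = c := by
  have : (d : ℝ) ≠ 0 := by exact_mod_cast hd
  simp [stepAverage]
  field_simp

lemma stepAverage_le (hd : d ≠ 0) {f : Zd d → ℝ} {x : Zd d} {c : ℝ}
    (h : ∀ i s, f (rwStep d i s x) ≤ c) : stepAverage d f x ≤ c :=
  (stepAverage_mono (g := fun _ => c) h).trans_eq (stepAverage_const hd c x)

lemma stepAverage_sum {ι : Type*} (t : Finset ι) (f : ι → Zd d → ℝ) (x : Zd d) :
    stepAverage d (fun y => ∑ k ∈ t, f k y) x = ∑ k ∈ t, stepAverage d (f k) x := by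
  simp only [stepAverage, ← Finset.mul_sum]
  rw [Finset.sum_comm (s := t)]
  simp only [Finset.sum_comm (s := t)]

lemma stepAverage_mul_const (f : Zd d → ℝ) (c : ℝ) (x : Zd d) :
    stepAverage d (fun y => f y * c) x = stepAverage d f x * c := by
  simp only [stepAverage, ← Finset.sum_mul, mul_assoc]

lemma stepAverage_tsum {ι : Type*} {f : ι → Zd d → ℝ} (hf : ∀ y, Summable fun k => f k y)
    (x : Zd d) :
    stepAverage d (fun y => ∑' k, f k y) x = ∑' k, stepAverage d (f k) x := by
  simp only [stepAverage]
  have hs : ∀ i : Fin d, Summable fun k => ∑ s : Bool, f k (rwStep d i s x) :=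
    fun i => summable_sum fun s _ => hf _
  rw [tsum_mul_left, Summable.tsum_finsetSum fun i _ => hs i]
  congr 1
  refine Finset.sum_congr rfl fun i _ => ?_
  rw [Summable.tsum_finsetSum fun s _ => hf _]

lemma stepAverage_comp_add (f : Zd d → ℝ) (x c : Zd d) :
    stepAverage d (fun y => f (y + c)) x = stepAverage d f (x + c) := by
  simp only [stepAverage, rwStep_eq_add, add_right_comm]

lemma stepAverage_comp_neg (f : Zd d → ℝ) (x : Zd d) :
    stepAverage d (fun y => f (-y)) x = stepAverage d f (-x) := by
  simp only [stepAverage, rwStep_eq_add, neg_add, neg_stepVec]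
  simp [add_comm]

lemma stepAverage_comp_perm (σ : Equiv.Perm (Fin d)) (f : Zd d → ℝ) (x : Zd d) :
    stepAverage d (fun y => f (y ∘ σ)) x = stepAverage d f (x ∘ σ) := by
  have h : ∀ i s, (rwStep d (σ i) s x) ∘ σ = rwStep d i s (x ∘ σ) := by
    intro i s
    funext j
    by_cases hj : j = i
    · subst hj; simp [rwStep]
    · simp [rwStep, hj]
  simp only [stepAverage, ← h]
  rw [Equiv.sum_comp σ (fun i => ∑ s : Bool, f ((rwStep d i s x) ∘ σ))]

lemma rwP_nonneg (m : ℕ) (a b : Zd d) : 0 ≤ rwP d m a b := by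
  induction m generalizing a with
  | zero => unfold rwP; split_ifs <;> norm_num
  | succ m ih =>
    exact mul_nonneg (by positivity)
      (Finset.sum_nonneg fun i _ => Finset.sum_nonneg fun s _ => ih _)

lemma rwP_le_one (hd : d ≠ 0) (m : ℕ) (a b : Zd d) : rwP d m a b ≤ 1 := by
  induction m generalizing a with
  | zero => unfold rwP; split_ifs <;> norm_num
  | succ m ih => exact stepAverage_le hd (f := fun y => rwP d m y b) fun i s => ih _

lemma rwP_eq_sub (m : ℕ) (a b : Zd d) : rwP d m a b = rwP d m (a - b) 0 := by
  induction m generalizing a with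
  | zero => simp [rwP, sub_eq_zero]
  | succ m ih =>
    simp only [rwP_succ, sub_eq_add_neg]
    rw [← stepAverage_comp_add]
    simp only [← sub_eq_add_neg, ← ih]

lemma rwP_neg (m : ℕ) (x : Zd d) : rwP d m (-x) 0 = rwP d m x 0 := by
  induction m generalizing x with
  | zero => simp [rwP]
  | succ m ih =>
    rw [rwP_succ, ← stepAverage_comp_neg, rwP_succ]
    simp only [ih]

lemma rwP_comp_perm (σ : Equiv.Perm (Fin d)) (m : ℕ) (x : Zd d) :
    rwP d m (x ∘ σ) 0 = rwP d m x 0 := by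
  induction m generalizing x with
  | zero =>
    have : x ∘ σ = 0 ↔ x = 0 := by
      constructor
      · intro h; funext j
        simpa using congrFun h (σ.symm j)
      · rintro rfl; rfl
    simp only [rwP, this]
  | succ m ih =>
    rw [rwP_succ, ← stepAverage_comp_perm σ (fun y => rwP d m y 0), rwP_succ]
    simp only [ih]

lemma rwP_stepVec (m : ℕ) (i j : Fin d) (s t : Bool) :
    rwP d m (stepVec d i s) 0 = rwP d m (stepVec d j t) 0 := by
  have hperm : ∀ s, rwP d m (stepVec d i s) 0 = rwP d m (stepVec d j s) 0 := by
    intro s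
    rw [← rwP_comp_perm (Equiv.swap i j)]
    congr 1
    funext k
    simp only [stepVec, Function.comp, Pi.single_apply]
    congr 1
    rw [Equiv.swap_apply_eq_iff, Equiv.swap_apply_left]
  rcases eq_or_ne s t with rfl | h
  · exact hperm s
  · have : t = !s := by cases s <;> cases t <;> simp_all
    rw [hperm, this, ← neg_stepVec, rwP_neg]

lemma summable_rwP_left (m : ℕ) : Summable fun x : Zd d => rwP d m x 0 := by
  induction m with
  | zero =>
    refine summable_of_ne_finset_zero (s := {0}) fun x hx => ?_
    simp_all [rwP]
  | succ m ih =>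
    simp only [rwP_succ, stepAverage, rwStep_eq_add]
    exact (summable_sum fun i _ => summable_sum fun s _ =>
      ih.comp_injective (add_left_injective (stepVec d i s))).mul_left _

lemma summable_rwP_mul (hd : d ≠ 0) (m k : ℕ) (x : Zd d) :
    Summable fun y : Zd d => rwP d m y 0 * rwP d k (x - y) 0 :=
  (summable_rwP_left m).of_nonneg_of_le
    (fun _ => mul_nonneg (rwP_nonneg _ _ _) (rwP_nonneg _ _ _))
    (fun _ => mul_le_of_le_one_right (rwP_nonneg _ _ _) (rwP_le_one hd _ _ _))

/-- Chapman–Kolmogorov. -/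
lemma rwP_add (hd : d ≠ 0) (m k : ℕ) (x : Zd d) :
    rwP d (m + k) x 0 = ∑' y, rwP d m y 0 * rwP d k (x - y) 0 := by
  induction m generalizing x with
  | zero =>
    rw [tsum_eq_single 0 fun y hy => by simp [rwP, hy]]
    simp [rwP]
  | succ m ih =>
    have hshift : ∀ e : Zd d, ∑' y, rwP d m (y + e) 0 * rwP d k (x - y) 0
        = rwP d (m + k) (x + e) 0 := by
      intro e
      rw [ih, ← (Equiv.addRight e).tsum_eq fun y => rwP d m y 0 * rwP d k (x + e - y) 0]
      simp
    have hs : ∀ e : Zd d, Summable fun y => rwP d m (y + e) 0 * rwP d k (x - y) 0 := by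
      intro e
      have := (summable_rwP_mul hd m k (x + e)).comp_injective (add_left_injective e)
      simpa [Function.comp_def] using this
    have key : ∀ y, rwP d (m + 1) y 0 * rwP d k (x - y) 0 =
        stepAverage d (fun z => rwP d m (y + (z - x)) 0 * rwP d k (x - y) 0) x := by
      intro y
      rw [stepAverage_mul_const, rwP_succ]
      simp only [stepAverage, rwStep_eq_add, add_sub_cancel_left]
    simp only [key]
    rw [← stepAverage_tsum fun z => hs (z - x)]
    simp only [hshift]
    rw [add_right_comm, rwP_succ]
    simp

lemma rwP_even_le (hd : d ≠ 0) (m : ℕ) (x : Zd d) :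
    rwP d (m + m) x 0 ≤ rwP d (m + m) 0 0 := by
  set f : Zd d → ℝ := fun y => rwP d m y 0 with hf
  have hdiag : ∀ y, rwP d m y 0 * rwP d m (0 - y) 0 = f y ^ 2 := by
    intro y; rw [zero_sub, rwP_neg, sq]
  have hsq : Summable fun y => f y ^ 2 := by
    simpa only [hdiag] using summable_rwP_mul hd m m 0
  have hsq' : Summable fun y => f (x - y) ^ 2 :=
    hsq.comp_injective (sub_right_injective (b := x))
  have hshift : ∑' y, f (x - y) ^ 2 = ∑' y, f y ^ 2 :=
    (Equiv.subLeft x).tsum_eq fun y => f y ^ 2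
  rw [rwP_add hd, rwP_add hd]
  simp only [hdiag]
  calc ∑' y, rwP d m y 0 * rwP d m (x - y) 0
      ≤ ∑' y, (1 / 2 * f y ^ 2 + 1 / 2 * f (x - y) ^ 2) := by
        refine (summable_rwP_mul hd m m x).tsum_le_tsum (fun y => ?_)
          ((hsq.mul_left _).add (hsq'.mul_left _))
        change f y * f (x - y) ≤ _
        nlinarith [sq_nonneg (f y - f (x - y))]
    _ = ∑' y, f y ^ 2 := by
        rw [(hsq.mul_left _).tsum_add (hsq'.mul_left _), tsum_mul_left, tsum_mul_left, hshift]
        ring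

lemma rwP_le_even (hd : d ≠ 0) (m : ℕ) (x : Zd d) :
    rwP d m x 0 ≤ rwP d (m / 2 + m / 2) 0 0 := by
  rcases Nat.even_or_odd' m with ⟨k, rfl | rfl⟩
  · have : 2 * k / 2 = k := by omega
    rw [this, two_mul]
    exact rwP_even_le hd k x
  · have : (2 * k + 1) / 2 = k := by omega
    rw [this, two_mul, rwP_succ]
    exact stepAverage_le hd fun i s => rwP_even_le hd k _

lemma sum_range_succ_rwP (M : ℕ) (x : Zd d) :
    ∑ m ∈ Finset.range (M + 1), rwP d m x 0 =
      stepAverage d (fun y => ∑ m ∈ Finset.range M, rwP d m y 0) x + if x = 0 then 1 else 0 := by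
  rw [Finset.sum_range_succ', stepAverage_sum]
  rfl

lemma sum_range_rwP_mono {M M' : ℕ} (h : M ≤ M') (x : Zd d) :
    ∑ m ∈ Finset.range M, rwP d m x 0 ≤ ∑ m ∈ Finset.range M', rwP d m x 0 :=
  Finset.sum_le_sum_of_subset_of_nonneg (Finset.range_mono h) fun _ _ _ => rwP_nonneg _ _ _

/-- Maximum principle: the expected number of visits to `0` is largest when starting at `0`. -/
lemma sum_range_rwP_le (hd : d ≠ 0) (M : ℕ) (x : Zd d) :
    ∑ m ∈ Finset.range M, rwP d m x 0 ≤ ∑ m ∈ Finset.range M, rwP d m 0 0 := by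
  induction M generalizing x with
  | zero => simp
  | succ M ih =>
    rcases eq_or_ne x 0 with rfl | hx
    · exact le_rfl
    · rw [sum_range_succ_rwP, if_neg hx, add_zero]
      exact (stepAverage_le hd fun i s => ih _).trans (sum_range_rwP_mono M.le_succ 0)

/-- Maximum principle: away from `0`, the expected number of visits to `0` is largest when
starting at a neighbour of `0`. -/
lemma sum_range_rwP_le_stepVec (hd : d ≠ 0) (i₀ : Fin d) (s₀ : Bool) (M : ℕ) {x : Zd d}
    (hx : x ≠ 0) :
    ∑ m ∈ Finset.range M, rwP d m x 0 ≤ ∑ m ∈ Finset.range M, rwP d m (stepVec d i₀ s₀) 0 := by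
  induction M generalizing x with
  | zero => simp
  | succ M ih =>
    by_cases hn : ∃ i s, x = stepVec d i s
    · obtain ⟨i, s, rfl⟩ := hn
      exact (Finset.sum_congr rfl fun m _ => rwP_stepVec m i i₀ s s₀).le
    · rw [sum_range_succ_rwP, if_neg hx, add_zero]
      refine (stepAverage_le hd fun i s => ih ?_).trans (sum_range_rwP_mono M.le_succ _)
      rw [rwStep_eq_add]
      intro h
      exact hn ⟨i, !s, by rw [← neg_stepVec]; exact eq_neg_of_add_eq_zero_left h⟩

lemma green_eq_sub (a b : Zd d) : green d a b = green d (a - b) 0 := by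
  simp only [green, ← rwP_eq_sub]

lemma green_self (a : Zd d) : green d a a = green d 0 0 := by
  rw [green_eq_sub, sub_self]

lemma green_comm (a b : Zd d) : green d a b = green d b a := by
  rw [green_eq_sub, green_eq_sub b a, ← neg_sub b a]
  simp only [green, rwP_neg]

lemma summable_rwP (hd : d ≠ 0) (hS : Summable fun m => rwP d m 0 0) (x : Zd d) : Summable fun m => rwP d m x 0 :=
  summable_of_sum_range_le (fun _ => rwP_nonneg _ _ _) fun M =>
    (sum_range_rwP_le hd M x).trans (hS.sum_le_tsum _ fun _ _ => rwP_nonneg _ _ _)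

lemma sum_range_rwP_le_green (hd : d ≠ 0) (hS : Summable fun m => rwP d m 0 0) (M : ℕ)
    (x : Zd d) : ∑ m ∈ Finset.range M, rwP d m x 0 ≤ green d x 0 :=
  (summable_rwP hd hS x).sum_le_tsum _ fun _ _ => rwP_nonneg _ _ _

lemma green_eq_stepAverage (hd : d ≠ 0) (hS : Summable fun m => rwP d m 0 0) (x : Zd d) :
    green d x 0 = (if x = 0 then 1 else 0) + stepAverage d (fun y => green d y 0) x := by
  unfold green
  rw [(summable_rwP hd hS x).tsum_eq_zero_add, stepAverage_tsum (summable_rwP hd hS)]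
  rfl

lemma green_stepVec (hd : d ≠ 0) (hS : Summable fun m => rwP d m 0 0) (i : Fin d) (s : Bool) :
    green d (stepVec d i s) 0 = green d 0 0 - 1 := by
  have h : stepAverage d (fun y => green d y 0) 0 = green d (stepVec d i s) 0 := by
    rw [← stepAverage_const hd (green d (stepVec d i s) 0) 0]
    simp only [stepAverage, rwStep_eq_add, zero_add]
    simp only [green, rwP_stepVec _ _ i _ s]
  have := green_eq_stepAverage hd hS 0
  rw [h, if_pos rfl] at this
  linarith

lemma green_le_sub_one (hd : d ≠ 0) (hS : Summable fun m => rwP d m 0 0) {x : Zd d}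
    (hx : x ≠ 0) : green d x 0 ≤ green d 0 0 - 1 := by
  let i : Fin d := ⟨0, Nat.pos_of_ne_zero hd⟩
  rw [← green_stepVec hd hS i true]
  exact Real.tsum_le_of_sum_range_le (fun _ => rwP_nonneg _ _ _) fun M =>
    (sum_range_rwP_le_stepVec hd i true M hx).trans (sum_range_rwP_le_green hd hS M _)

lemma green_nonneg (a b : Zd d) : 0 ≤ green d a b := tsum_nonneg fun _ => rwP_nonneg _ _ _

lemma one_lt_green (hd : d ≠ 0) (hS : Summable fun m => rwP d m 0 0) : 1 < green d 0 0 := by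
  let i : Fin d := ⟨0, Nat.pos_of_ne_zero hd⟩
  have hd' : (0 : ℝ) < d := by exact_mod_cast Nat.pos_of_ne_zero hd
  have h0 : 0 < rwP d 1 (stepVec d i true) 0 := by
    refine mul_pos (by positivity) (Finset.sum_pos' (fun j _ => Finset.sum_nonneg fun s _ =>
      rwP_nonneg _ _ _) ⟨i, Finset.mem_univ _, Finset.sum_pos' (fun s _ => rwP_nonneg _ _ _)
        ⟨false, Finset.mem_univ _, ?_⟩⟩)
    rw [rwStep_eq_add, show stepVec d i false = -stepVec d i true from (neg_stepVec i true).symm]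
    simp [rwP]
  have h1 : rwP d 1 (stepVec d i true) 0 ≤ green d (stepVec d i true) 0 :=
    (summable_rwP hd hS _).le_tsum 1 fun _ _ => rwP_nonneg _ _ _
  rw [green_stepVec hd hS] at h1
  linarith

lemma green_tendsto_zero (hd : d ≠ 0) (hS : Summable fun m => rwP d m 0 0) :
    Tendsto (fun x : Zd d => green d x 0) cofinite (nhds 0) := by
  have hbound : Summable fun m => rwP d (m / 2 + m / 2) 0 0 := by
    have h2 : Summable fun k => rwP d (2 * k) 0 0 :=
      hS.comp_injective (mul_right_injective₀ two_ne_zero)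
    refine Summable.even_add_odd ?_ ?_
    · refine h2.congr fun k => ?_
      rw [show 2 * k / 2 + 2 * k / 2 = 2 * k by omega]
    · refine h2.congr fun k => ?_
      rw [show (2 * k + 1) / 2 + (2 * k + 1) / 2 = 2 * k by omega]
  have := tendsto_tsum_of_dominated_convergence (𝓕 := cofinite)
    (f := fun x m => rwP d m x 0) (g := fun _ => (0 : ℝ)) hbound
    (fun m => (summable_rwP_left m).tendsto_cofinite_zero)
    (Eventually.of_forall fun x m => by
      rw [Real.norm_of_nonneg (rwP_nonneg _ _ _)]
      exact rwP_le_even hd m x)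
  simpa [green] using this

lemma hitP_succ_of_ne (m : ℕ) {x : Zd d} (hx : x ≠ 0) :
    hitP d {0} (m + 1) x 0 = stepAverage d (fun y => hitP d {0} m y 0) x := by
  simp [hitP, hx, stepAverage]

lemma hitP_nonneg (F : Set (Zd d)) (m : ℕ) (a b : Zd d) : 0 ≤ hitP d F m a b := by
  induction m generalizing a with
  | zero => unfold hitP; split_ifs <;> norm_num
  | succ m ih =>
    unfold hitP
    split_ifs
    · exact le_rfl
    · exact mul_nonneg (by positivity)
        (Finset.sum_nonneg fun i _ => Finset.sum_nonneg fun s _ => ih _)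

/-- First-passage decomposition of the visits to `0`. -/
lemma rwP_eq_sum_hitP (m : ℕ) (x : Zd d) :
    rwP d m x 0 = ∑ k ∈ Finset.range (m + 1), hitP d {0} k x 0 * rwP d (m - k) 0 0 := by
  rcases eq_or_ne x 0 with rfl | hx
  · rw [Finset.sum_range_succ']
    simp [hitP]
  induction m generalizing x with
  | zero => simp [rwP, hitP, hx]
  | succ m ih =>
    have ih' : ∀ y, rwP d m y 0 =
        ∑ k ∈ Finset.range (m + 1), hitP d {0} k y 0 * rwP d (m - k) 0 0 := by
      intro y
      rcases eq_or_ne y 0 with rfl | hy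
      · rw [Finset.sum_range_succ']
        simp [hitP]
      · exact ih y hy
    rw [Finset.sum_range_succ', rwP_succ]
    simp only [ih', stepAverage_sum, stepAverage_mul_const, hitP_succ_of_ne _ hx,
      Nat.add_sub_add_right]
    simp [hitP, hx]

lemma hitP_le_rwP (m : ℕ) (x : Zd d) : hitP d {0} m x 0 ≤ rwP d m x 0 := by
  rw [rwP_eq_sum_hitP]
  refine le_trans ?_ (Finset.single_le_sum (fun k _ => mul_nonneg (hitP_nonneg _ _ _ _)
    (rwP_nonneg _ _ _)) (Finset.self_mem_range_succ m))
  simp [rwP]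

lemma hitMeas_mul_green (hd : d ≠ 0) (hS : Summable fun m => rwP d m 0 0) (x : Zd d) :
    hitMeas d {0} x 0 * green d 0 0 = green d x 0 := by
  have hH : Summable fun m => hitP d {0} m x 0 :=
    (summable_rwP hd hS x).of_nonneg_of_le (fun _ => hitP_nonneg _ _ _ _) (hitP_le_rwP · x)
  unfold hitMeas green
  rw [tsum_mul_tsum_eq_tsum_sum_range_of_summable_norm hH.norm hS.norm]
  simp only [← rwP_eq_sum_hitP]

/-- `κ = 1 / g(0)`. -/
lemma kappa_mul_green (hd : d ≠ 0) (hS : Summable fun m => rwP d m 0 0) :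
    kappa d * green d 0 0 = 1 := by
  have h1 : returnProb d = stepAverage d (fun y => hitMeas d {0} y 0) 0 := rfl
  have h2 : returnProb d * green d 0 0 = stepAverage d (fun y => green d y 0) 0 := by
    rw [h1, ← stepAverage_mul_const]
    simp only [hitMeas_mul_green hd hS]
  have h3 := green_eq_stepAverage hd hS 0
  rw [if_pos rfl] at h3
  rw [kappa, sub_mul, h2]
  linarith

end RandomWalk

section Gaussian

lemma gaussianReal_real_Ici_le (v : NNReal) {t : ℝ} (ht : 0 ≤ t) :
    (gaussianReal 0 v).real (Set.Ici t) ≤ Real.exp (-t ^ 2 / (2 * v)) := by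
  have h : HasSubgaussianMGF (id : ℝ → ℝ) v (gaussianReal 0 v) :=
    ⟨fun t => integrable_exp_mul_gaussianReal t, fun t => by
      rw [mgf_id_gaussianReal]; simp⟩
  exact h.measure_ge_le ht

variable {d : ℕ} {Ω : Type*} [MeasurableSpace Ω] {P : Measure Ω} {φ : Zd d → Ω → ℝ}

lemma IsGaussianField.map_eq {G : Zd d → Zd d → ℝ} (hφ : IsGaussianField P d G φ) (a : Zd d) :
    P.map (φ a) = gaussianReal 0 (G a a).toNNReal := by
  have h := hφ.2 (Finsupp.single a 1)
  simpa [Finsupp.support_single] using h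

lemma IsGaussianField.map_add_eq {G : Zd d → Zd d → ℝ} (hφ : IsGaussianField P d G φ)
    {a b : Zd d} (hab : a ≠ b) :
    P.map (fun ω => φ a ω + φ b ω) =
      gaussianReal 0 (G a a + G a b + (G b a + G b b)).toNNReal := by
  classical
  have h := hφ.2 (Finsupp.single a 1 + Finsupp.single b 1)
  have hs : (Finsupp.single a (1 : ℝ) + Finsupp.single b 1).support = {a, b} := by
    rw [Finsupp.support_add_eq]
    · simp [Finsupp.support_single]
    · simpa [Finsupp.support_single] using hab
  simpa [hs, Finset.sum_pair hab, Finsupp.single_apply, hab, hab.symm] using h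

lemma IsGaussianField.prob_pair_le [IsProbabilityMeasure P]
    (hφ : IsGaussianField P d (green d) φ) {a b : Zd d} (hab : a ≠ b) {u c : ℝ} (hu : 0 ≤ u)
    (hg : 0 < green d 0 0) (hc : green d (a - b) 0 ≤ c) :
    (P {ω | u < φ a ω ∧ u < φ b ω}).toReal ≤ Real.exp (-(u ^ 2 / (green d 0 0 + c))) := by
  have hmeas : Measurable fun ω => φ a ω + φ b ω := (hφ.1 a).add (hφ.1 b)
  have hg' := green_nonneg (a - b) (0 : Zd d)
  have hv : green d a a + green d a b + (green d b a + green d b b) =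
      2 * (green d 0 0 + green d (a - b) 0) := by
    rw [green_self a, green_self b, green_comm b a, green_eq_sub a b]; ring
  calc (P {ω | u < φ a ω ∧ u < φ b ω}).toReal
      ≤ P.real ((fun ω => φ a ω + φ b ω) ⁻¹' Set.Ici (2 * u)) := by
        refine measureReal_mono fun ω hω => ?_
        simp only [Set.mem_ofPred_eq] at hω
        simp only [Set.mem_preimage, Set.mem_Ici]
        linarith [hω.1, hω.2]
    _ = (P.map fun ω => φ a ω + φ b ω).real (Set.Ici (2 * u)) := by
        rw [map_measureReal_apply hmeas measurableSet_Ici]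
    _ ≤ Real.exp (-(2 * u) ^ 2 / (2 * (2 * (green d 0 0 + green d (a - b) 0)).toNNReal)) := by
        rw [hφ.map_add_eq hab, hv]
        exact gaussianReal_real_Ici_le _ (by positivity)
    _ ≤ Real.exp (-(u ^ 2 / (green d 0 0 + c))) := by
        rw [Real.coe_toNNReal _ (by positivity)]
        have : -(2 * u) ^ 2 / (2 * (2 * (green d 0 0 + green d (a - b) 0))) =
            -(u ^ 2 / (green d 0 0 + green d (a - b) 0)) := by
          field_simp
        rw [this]
        gcongr

lemma card_filter_sub_mem_le [DecidableEq (Zd d)] (V T : Finset (Zd d)) :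
    ((V ×ˢ V).filter fun p => p.1 - p.2 ∈ T).card ≤ V.card * T.card := by
  rw [← Finset.card_product]
  refine Finset.card_le_card_of_injOn (fun p => (p.1, p.1 - p.2)) (fun p hp => ?_)
    (fun p _ q _ h => ?_)
  · simp only [Finset.coe_filter, Finset.mem_product, Set.mem_ofPred_eq] at hp
    simp [hp.1.1, hp.2]
  · simp only [Prod.mk.injEq] at h
    exact Prod.ext h.1 (by simpa [h.1] using h.2)

lemma card_VN (n : ℕ) : (VN d n).card = n ^ d := by
  simp [VN]

/-- The box `[-D, D]^d`. -/
noncomputable def centeredBox (d D : ℕ) : Finset (Zd d) :=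
  Fintype.piFinset fun _ => Finset.Icc (-D : ℤ) D

lemma card_centeredBox (D : ℕ) : (centeredBox d D).card = (2 * D + 1) ^ d := by
  simp only [centeredBox, Fintype.card_piFinset, Int.card_Icc, Finset.prod_const,
    Finset.card_univ, Fintype.card_fin]
  congr 1
  omega

lemma sub_mem_centeredBox {a b : Zd d} {r : ℝ} (h : distInf d a b ≤ r) :
    a - b ∈ centeredBox d ⌊r⌋₊ := by
  have h' := Nat.le_floor h
  rw [Finset.sup_le_iff] at h'
  simp only [centeredBox, Fintype.mem_piFinset, Finset.mem_Icc, Pi.sub_apply]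
  intro i
  have := h' i (Finset.mem_univ i)
  omega

/-- Splitting the pair sum according to whether `α - β` lies in a finite set `T` outside of
which the Green's function is at most `c`. -/
lemma pairSum_le [IsProbabilityMeasure P] (hφ : IsGaussianField P d (green d) φ)
    (hd : d ≠ 0) (hS : Summable fun m => rwP d m 0 0) {c : ℝ} (T : Finset (Zd d))
    (hT : ∀ x ∉ T, green d x 0 ≤ c) (n : ℕ) (z ε : ℝ)
    (hu : 0 ≤ uN (green d 0 0) (n ^ d) z) :
    pairSum d n ε P φ z ≤ (n ^ d : ℕ) *
      (T.card * Real.exp (-(uN (green d 0 0) (n ^ d) z ^ 2 /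
          (green d 0 0 + (green d 0 0 - 1)))) +
        (2 * ⌊Real.log ((n ^ d : ℕ) : ℝ) ^ (2 + 2 * ε)⌋₊ + 1) ^ d *
          Real.exp (-(uN (green d 0 0) (n ^ d) z ^ 2 / (green d 0 0 + c)))) := by
  classical
  set u := uN (green d 0 0) (n ^ d) z
  set D := ⌊Real.log ((n ^ d : ℕ) : ℝ) ^ (2 + 2 * ε)⌋₊
  set E₁ := Real.exp (-(u ^ 2 / (green d 0 0 + (green d 0 0 - 1))))
  set E₂ := Real.exp (-(u ^ 2 / (green d 0 0 + c)))
  have hE₁ : 0 < E₁ := Real.exp_pos _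
  have hE₂ : 0 < E₂ := Real.exp_pos _
  have hg : 0 < green d 0 0 := one_pos.trans (one_lt_green hd hS)
  have hcard : ∀ B : Finset (Zd d),
      ∑ p ∈ VN d n ×ˢ VN d n, (if p.1 - p.2 ∈ B then (1 : ℝ) else 0) ≤
        (n ^ d : ℕ) * B.card := by
    intro B
    rw [Finset.sum_boole, ← card_VN n]
    exact_mod_cast card_filter_sub_mem_le (VN d n) B
  have hterm : ∀ p : Zd d × Zd d, p.1 ≠ p.2 →
      distInf d p.1 p.2 ≤ Real.log ((n ^ d : ℕ) : ℝ) ^ (2 + 2 * ε) →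
      (P {ω | u < φ p.1 ω ∧ u < φ p.2 ω}).toReal ≤
        (if p.1 - p.2 ∈ T then 1 else 0) * E₁ +
          (if p.1 - p.2 ∈ centeredBox d D then 1 else 0) * E₂ := by
    intro p hp hdist
    rw [if_pos (sub_mem_centeredBox hdist)]
    split_ifs with hpT
    · have := hφ.prob_pair_le hp hu hg (green_le_sub_one hd hS (sub_ne_zero.2 hp))
      linarith
    · have := hφ.prob_pair_le hp hu hg (hT _ hpT)
      linarith
  calc pairSum d n ε P φ z
      ≤ ∑ p ∈ VN d n ×ˢ VN d n, ((if p.1 - p.2 ∈ T then 1 else 0) * E₁ +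
          (if p.1 - p.2 ∈ centeredBox d D then 1 else 0) * E₂) := by
        refine (Finset.sum_le_sum fun p hp => ?_).trans
          (Finset.sum_le_sum_of_subset_of_nonneg (Finset.filter_subset _ _)
            fun p _ _ => by positivity)
        obtain ⟨-, hp⟩ := Finset.mem_filter.1 hp
        exact hterm p hp.1 hp.2
    _ ≤ (n ^ d : ℕ) * T.card * E₁ + (n ^ d : ℕ) * (centeredBox d D).card * E₂ := by
        rw [Finset.sum_add_distrib, ← Finset.sum_mul, ← Finset.sum_mul]
        gcongr
        · exact hcard T
        · exact hcard _
    _ = _ := by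
        rw [card_centeredBox]
        push_cast
        ring

lemma pairSum_eq_zero_of_green_eq_zero (hφ : IsGaussianField P d (green d) φ)
    (hg : green d 0 0 = 0) (n : ℕ) (z ε : ℝ) : pairSum d n ε P φ z = 0 := by
  have hu : uN (green d 0 0) (n ^ d) z = 0 := by simp [hg, uN, aN, bN]
  refine Finset.sum_eq_zero fun p _ => ?_
  rw [hu]
  have h0 : P (φ p.1 ⁻¹' Set.Ioi 0) = 0 := by
    rw [← Measure.map_apply (hφ.1 _) measurableSet_Ioi, hφ.map_eq, green_self, hg]
    simp
  rw [measure_mono_null (fun ω hω => hω.1) h0]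
  simp

lemma pairSum_eq_zero_of_le_one {n : ℕ} (hn : n ≤ 1) (z ε : ℝ) :
    pairSum d n ε P φ z = 0 := by
  refine Finset.sum_eq_zero fun p hp => ?_
  obtain ⟨hV, hne, -⟩ := Finset.mem_filter.1 hp
  simp only [Finset.mem_product, VN, Fintype.mem_piFinset, Finset.mem_Icc] at hV
  refine absurd (funext fun i => ?_) hne
  have h1 := hV.1 i
  have h2 := hV.2 i
  omega

end Gaussian

section Asymptotics

lemma uN_nonneg_and_sq_ge {g : ℝ} (hg : 0 < g) (z : ℝ) (N : ℕ)
    (hL : 1 + Real.log (4 * π) + |z| ≤ Real.log N) :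
    0 ≤ uN g N z ∧
      g * (2 * Real.log N - Real.log (Real.log N) - (Real.log (4 * π) + 2 * |z|)) ≤
        uN g N z ^ 2 := by
  have hpi : 0 < Real.log (4 * π) := Real.log_pos (by linarith [Real.pi_gt_three])
  have hz := abs_nonneg z
  set L := Real.log N
  have hL0 : 0 < L := by linarith
  have hlog : Real.log L ≤ L - 1 := Real.log_le_sub_one_of_pos hL0
  set w := Real.log L + Real.log (4 * π) with hw
  set s := √(2 * L) with hs
  have hs0 : 0 < s := Real.sqrt_pos.2 (by linarith)
  have hss : s ^ 2 = 2 * L := Real.sq_sqrt (by linarith)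
  have hbdef : bN g N = √g * (s - w / (2 * s)) := rfl
  set b := bN g N
  have hb0 : 0 < b := by
    rw [hbdef]
    refine mul_pos (Real.sqrt_pos.2 hg) (sub_pos.2 ?_)
    rw [div_lt_iff₀ (by positivity)]
    nlinarith
  have hb : g * (2 * L - w) ≤ b ^ 2 := by
    have : b ^ 2 = g * (s ^ 2 - w + (w / (2 * s)) ^ 2) := by
      rw [hbdef, mul_pow, Real.sq_sqrt hg.le]
      field_simp
      ring
    rw [this, hss]
    nlinarith [sq_nonneg (w / (2 * s))]
  have hudef : uN g N z = g / b * z + b := rfl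
  constructor
  · have : uN g N z = (g * z + b ^ 2) / b := by rw [hudef]; field_simp
    rw [this]
    refine div_nonneg ?_ hb0.le
    nlinarith [neg_abs_le z]
  · have : uN g N z ^ 2 = b ^ 2 + 2 * g * z + (g / b * z) ^ 2 := by
      rw [hudef]; field_simp; ring
    rw [this]
    nlinarith [neg_abs_le z, sq_nonneg (g / b * z)]

lemma exp_neg_sq_div_le {g q u L K : ℝ} (hg : 0 < g) (hq : 1 ≤ q) (hL : 1 ≤ L) (hK : 0 ≤ K)
    (hu : g * (2 * L - Real.log L - K) ≤ u ^ 2) :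
    Real.exp (-(u ^ 2 / (g * q))) ≤ Real.exp (-(2 * L / q)) * (L * Real.exp K) := by
  have hq0 : 0 < q := by linarith
  rw [← Real.exp_log (show 0 < L by linarith), ← Real.exp_add, ← Real.exp_add,
    Real.exp_log (show 0 < L by linarith)]
  apply Real.exp_le_exp.2
  have h1 : (2 * L - Real.log L - K) / q ≤ u ^ 2 / (g * q) := by
    rw [div_le_div_iff₀ hq0 (by positivity)]
    nlinarith
  have h2 : (Real.log L + K) / q ≤ Real.log L + K :=
    div_le_self (add_nonneg (Real.log_nonneg hL) hK) hq
  have h3 : (2 * L - Real.log L - K) / q = 2 * L / q - (Real.log L + K) / q := by ring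
  linarith

lemma mul_exp_neg_le {η L : ℝ} (hη : 0 < η) : L * Real.exp (-(η * L)) ≤ 1 / η := by
  rw [Real.exp_neg, ← div_eq_mul_inv, div_le_div_iff₀ (Real.exp_pos _) hη]
  linarith [Real.add_one_le_exp (η * L)]

end Asymptotics

/-- A bound that holds eventually up to a constant holds everywhere up to a constant, provided
it is nontrivial wherever it is needed. -/
lemma exists_forall_le_mul_of_eventually {f r : ℕ → ℝ} {c : ℝ} (hf : ∀ n, 0 ≤ f n)
    (hr : ∀ n, 0 ≤ r n) (hfr : ∀ n, r n = 0 → f n = 0) (h : ∀ᶠ n in atTop, f n ≤ c * r n) :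
    ∃ C > (0 : ℝ), ∀ n, f n ≤ C * r n := by
  obtain ⟨n₀, hn₀⟩ := eventually_atTop.1 h
  have hnn : ∀ k, 0 ≤ f k / r k := fun k => div_nonneg (hf k) (hr k)
  have hsum : 0 ≤ ∑ k ∈ Finset.range n₀, f k / r k := Finset.sum_nonneg fun k _ => hnn k
  refine ⟨1 + |c| + ∑ k ∈ Finset.range n₀, f k / r k, by positivity, fun n => ?_⟩
  rcases (hr n).eq_or_lt with h0 | h0
  · rw [hfr n h0.symm, ← h0, mul_zero]
  rcases le_or_gt n₀ n with hn | hn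
  · refine (hn₀ n hn).trans (mul_le_mul_of_nonneg_right ?_ h0.le)
    linarith [le_abs_self c]
  · have := Finset.single_le_sum (fun k _ => hnn k) (Finset.mem_range.2 hn)
    rw [← div_le_iff₀ h0]
    linarith [abs_nonneg c]

section Transient

variable {d : ℕ} {Ω : Type*} [MeasurableSpace Ω] {P : Measure Ω} {φ : Zd d → Ω → ℝ}

lemma tendsto_log_pow_atTop (hd : d ≠ 0) :
    Tendsto (fun n : ℕ => Real.log ((n ^ d : ℕ) : ℝ)) atTop atTop :=
  Real.tendsto_log_atTop.comp (tendsto_natCast_atTop_atTop.comp (tendsto_pow_atTop hd))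

lemma kappa_mem_Ioo (hd : d ≠ 0) (hS : Summable fun m => rwP d m 0 0) :
    kappa d ∈ Set.Ioo (0 : ℝ) 1 := by
  have h1 := one_lt_green hd hS
  have h2 := kappa_mul_green hd hS
  constructor <;> nlinarith

lemma eventually_pairSum_le [IsProbabilityMeasure P] (hφ : IsGaussianField P d (green d) φ)
    (hd : d ≠ 0) (hS : Summable fun m => rwP d m 0 0) (z : ℝ) {ε : ℝ} (hε : 0 < ε) :
    ∃ c : ℝ, ∀ᶠ n : ℕ in atTop, pairSum d n ε P φ z ≤
      c * (((n ^ d : ℕ) : ℝ) ^ (-(kappa d) / (2 - kappa d)) *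
        (Real.log ((n ^ d : ℕ) : ℝ)) ^ ((d : ℝ) * (2 + 2 * ε))) := by
  have hg1 := one_lt_green hd hS
  have hκg := kappa_mul_green hd hS
  obtain ⟨hκ0, hκ1⟩ := kappa_mem_Ioo hd hS
  set g := green d 0 0
  set κ := kappa d
  have hg : 0 < g := by linarith
  have hfin : {x : Zd d | ¬ green d x 0 ≤ (g - 1) / 2}.Finite :=
    (green_tendsto_zero hd hS).eventually_le_const (by linarith : (0 : ℝ) < (g - 1) / 2)
  set T := hfin.toFinset
  have hT : ∀ x ∉ T, green d x 0 ≤ (g - 1) / 2 := fun x hx => by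
    simpa [T] using hx
  set q := 2 - κ with hq
  set q' := (3 - κ) / 2 with hq'
  have hgq : g + (g - 1) = g * q := by rw [hq]; linarith
  have hgq' : g + (g - 1) / 2 = g * q' := by rw [hq']; linarith
  set K := Real.log (4 * π) + 2 * |z| with hK
  have hK0 : 0 ≤ K := by
    have : 0 < Real.log (4 * π) := Real.log_pos (by linarith [Real.pi_gt_three])
    positivity
  set η := 2 / q' - 2 / q with hη
  have hη0 : 0 < η := by
    rw [hη, sub_pos]
    exact div_lt_div_of_pos_left two_pos (by rw [hq']; linarith) (by rw [hq', hq]; linarith)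
  refine ⟨T.card * Real.exp K + 3 ^ d * (1 / η * Real.exp K), ?_⟩
  filter_upwards [(tendsto_log_pow_atTop hd).eventually_ge_atTop (1 + Real.log (4 * π) + |z|),
    (tendsto_log_pow_atTop hd).eventually_ge_atTop 1, eventually_ge_atTop 1] with n hLz hL1 hn
  obtain ⟨hu0, hu⟩ := uN_nonneg_and_sq_ge hg z (n ^ d) hLz
  refine (pairSum_le hφ hd hS T hT n z ε hu0).trans ?_
  rw [hgq, hgq']
  have hx0 : (0 : ℝ) < ((n ^ d : ℕ) : ℝ) := by positivity
  set x : ℝ := ((n ^ d : ℕ) : ℝ)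
  set L := Real.log x with hL
  set R := L ^ (2 + 2 * ε) with hR
  set u := uN g (n ^ d) z
  have hR1 : 1 ≤ R := Real.one_le_rpow hL1 (by positivity)
  have hRd : L ^ ((d : ℝ) * (2 + 2 * ε)) = R ^ d := by
    rw [hR, ← Real.rpow_natCast, ← Real.rpow_mul (by linarith)]
    ring_nf
  have hLR : L ≤ R ^ d := by
    calc L = L ^ (1 : ℝ) := (Real.rpow_one L).symm
      _ ≤ R := Real.rpow_le_rpow_of_exponent_le hL1 (by linarith)
      _ ≤ R ^ d := le_self_pow₀ hR1 hd
  have hbox : (2 * (⌊R⌋₊ : ℝ) + 1) ^ d ≤ 3 ^ d * R ^ d := by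
    rw [← mul_pow]
    have := Nat.floor_le (zero_le_one.trans hR1)
    gcongr
    linarith
  have hxκ : x ^ (-κ / q) = x * Real.exp (-(2 * L / q)) := by
    have hxe : x = Real.exp L := (Real.exp_log hx0).symm
    rw [Real.rpow_def_of_pos hx0, ← hL]
    conv_rhs => rw [hxe, ← Real.exp_add]
    congr 1
    have : q ≠ 0 := by rw [hq]; linarith
    field_simp
    rw [hq]; ring
  have hE₁ := exp_neg_sq_div_le (q := q) hg (by rw [hq]; linarith) hL1 hK0 hu
  have hE₂ := exp_neg_sq_div_le (q := q') hg (by rw [hq']; linarith) hL1 hK0 hu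
  have hE₂' : Real.exp (-(u ^ 2 / (g * q'))) ≤
      Real.exp (-(2 * L / q)) * (1 / η * Real.exp K) := by
    refine hE₂.trans ?_
    have hsplit : Real.exp (-(2 * L / q')) =
        Real.exp (-(2 * L / q)) * Real.exp (-(η * L)) := by
      rw [← Real.exp_add, hη]; congr 1; ring
    calc _ = Real.exp (-(2 * L / q)) * ((L * Real.exp (-(η * L))) * Real.exp K) := by
          rw [hsplit]; ring
      _ ≤ _ := by gcongr; exact mul_exp_neg_le hη0
  rw [hxκ, hRd]
  calc x * (T.card * Real.exp (-(u ^ 2 / (g * q))) +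
        (2 * (⌊R⌋₊ : ℝ) + 1) ^ d * Real.exp (-(u ^ 2 / (g * q'))))
      ≤ x * (T.card * (Real.exp (-(2 * L / q)) * (R ^ d * Real.exp K)) +
        (3 ^ d * R ^ d) * (Real.exp (-(2 * L / q)) * (1 / η * Real.exp K))) := by
        gcongr
        exact hE₁.trans (by gcongr)
    _ = _ := by ring

end Transient

/-- Bound on the two-point correlations of high points of the infinite-volume
DGFF over nearby pairs in `V_N`; in particular, the pair sum tends to `0`. -/
theorem pair_correlation_bound
    (d : ℕ) (hd : 3 ≤ d)
    {Ω : Type*} [MeasurableSpace Ω] (P : Measure Ω) [IsProbabilityMeasure P]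
    (φ : Zd d → Ω → ℝ) (hφ : IsGaussianField P d (green d) φ)
    (z ε : ℝ) (hε : 0 < ε) :
    (∃ C' > (0 : ℝ), ∀ n : ℕ,
      pairSum d n ε P φ z
        ≤ C' * ((n ^ d : ℕ) : ℝ) ^ (-(kappa d) / (2 - kappa d))
            * (Real.log ((n ^ d : ℕ) : ℝ)) ^ ((d : ℝ) * (2 + 2 * ε))
            * max (if z ≤ 0 then Real.exp (-2 * z) else 0)
                  (if 0 < z then Real.exp (-2 * z / (2 - kappa d)) else 0)) ∧
      Tendsto (fun n : ℕ => pairSum d n ε P φ z) atTop (nhds 0) := by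
  have hd0 : d ≠ 0 := by omega
  set Z := max (if z ≤ 0 then Real.exp (-2 * z) else 0)
    (if 0 < z then Real.exp (-2 * z / (2 - kappa d)) else 0) with hZ
  have hZ0 : 0 < Z := by
    rcases le_or_gt z 0 with h | h
    · exact lt_max_of_lt_left (by rw [if_pos h]; exact Real.exp_pos _)
    · exact lt_max_of_lt_right (by rw [if_pos h]; exact Real.exp_pos _)
  have hlog : ∀ n : ℕ, 0 ≤ Real.log ((n ^ d : ℕ) : ℝ) := fun n => Real.log_natCast_nonneg _
  by_cases hS : Summable fun m => rwP d m 0 0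
  swap
  -- for a divergent series `green d 0 0 = 0`, and the field vanishes almost surely
  · have hzero := fun n =>
      pairSum_eq_zero_of_green_eq_zero hφ (tsum_eq_zero_of_not_summable hS) n z ε
    simp only [hzero]
    refine ⟨⟨1, one_pos, fun n => ?_⟩, tendsto_const_nhds⟩
    have := hlog n
    positivity
  obtain ⟨hκ0, hκ1⟩ := kappa_mem_Ioo hd0 hS
  obtain ⟨c, hc⟩ := eventually_pairSum_le hφ hd0 hS z hε
  set r : ℕ → ℝ := fun n => ((n ^ d : ℕ) : ℝ) ^ (-(kappa d) / (2 - kappa d)) *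
    (Real.log ((n ^ d : ℕ) : ℝ)) ^ ((d : ℝ) * (2 + 2 * ε)) with hr
  have hr0 : ∀ n, 0 ≤ r n := fun n => by
    have := hlog n
    positivity
  have hf0 : ∀ n, 0 ≤ pairSum d n ε P φ z := fun n =>
    Finset.sum_nonneg fun _ _ => ENNReal.toReal_nonneg
  have hfr : ∀ n, r n = 0 → pairSum d n ε P φ z = 0 := by
    intro n hn
    refine pairSum_eq_zero_of_le_one (not_lt.1 fun h1 => ?_) z ε
    have hx : (1 : ℝ) < ((n ^ d : ℕ) : ℝ) := by exact_mod_cast Nat.one_lt_pow hd0 h1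
    have hlx := Real.log_pos hx
    have : 0 < r n := by positivity
    exact this.ne' hn
  obtain ⟨C, hC, hbound⟩ := exists_forall_le_mul_of_eventually hf0 hr0 hfr hc
  refine ⟨⟨C / Z, by positivity, fun n => ?_⟩, ?_⟩
  · refine (hbound n).trans_eq ?_
    simp only [hr]
    field_simp
  · have hlim : Tendsto r atTop (nhds 0) := by
      have hδ : 0 < kappa d / (2 - kappa d) := div_pos hκ0 (by linarith)
      have h1 := (isLittleO_log_rpow_rpow_atTop ((d : ℝ) * (2 + 2 * ε)) hδ).tendsto_div_nhds_zero
      refine (h1.comp (tendsto_natCast_atTop_atTop.comp (tendsto_pow_atTop hd0))).congr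
        fun n => ?_
      simp only [Function.comp_apply, hr]
      rw [neg_div, Real.rpow_neg (Nat.cast_nonneg _), div_eq_inv_mul]
    have := hlim.const_mul C
    rw [mul_zero] at this
    exact squeeze_zero hf0 hbound this
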